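/- arXiv:1704.08281 — 3 statements merged into one kernel-verified Lean document; each statement's English description precedes it below -/
import Mathlib

section
/- For every positive integer N, the probability measure μ_N on [0,1) with density x ↦ 1/((ln(N+1) − ln N)·(N + x)) with respect to Lebesgue measure is invariant under the generalized Gauss transformation T_N, i.e. μ_N(T_N^{-1}(A)) = μ_N(A) for every Borel set A ⊆ [0,1). -/
open MeasureTheory Filter Set

/-- The generalized Gauss transformation `T_N(x) = {N/x}` (and `T_N(0) = 0`). -/
noncomputable def gaussT (N : ℕ) (x : ℝ) : ℝ :=
  if x = 0 then 0 else Int.fract ((N : ℝ) / x)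

/-- The measure `μ_N` on `[0,1)` with density
`x ↦ 1 / ((log (N+1) - log N) * (N + x))` w.r.t. Lebesgue measure. -/
noncomputable def gaussMu (N : ℕ) : Measure ℝ :=
  (volume.restrict (Set.Ico (0:ℝ) 1)).withDensity
    (fun x => ENNReal.ofReal (1 / ((Real.log (N + 1) - Real.log N) * (N + x))))

theorem gaussMu_apply (N : ℕ) (s : Set ℝ) :
    gaussMu N s = ∫⁻ x in s ∩ Set.Ico (0:ℝ) 1,
      ENNReal.ofReal (1 / ((Real.log (N + 1) - Real.log N) * (N + x))) := by
  rw [gaussMu, withDensity_apply', Measure.restrict_restrict' measurableSet_Ico]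

/-- The inverse branches of `gaussT N`, indexed by the excess `k` of the digit over `N`. -/
noncomputable def gaussBranch (N k : ℕ) (y : ℝ) : ℝ := N / (N + k + y)

theorem gaussBranch_denom_pos {N : ℕ} (hN : 0 < N) (k : ℕ) {y : ℝ} (hy : 0 ≤ y) :
    (0:ℝ) < N + k + y := by
  have : (0:ℝ) < N := by exact_mod_cast hN
  positivity

theorem hasDerivAt_gaussBranch {N : ℕ} (hN : 0 < N) (k : ℕ) {y : ℝ} (hy : 0 ≤ y) :
    HasDerivAt (gaussBranch N k) (-N / (N + k + y) ^ 2) y := by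
  have h := (hasDerivAt_const y (N:ℝ)).div ((hasDerivAt_id y).const_add ((N:ℝ) + k))
    (gaussBranch_denom_pos hN k hy).ne'
  simp only [id_eq, zero_mul, mul_one, zero_sub] at h
  exact h

theorem gaussBranch_eq_iff {N : ℕ} (hN : 0 < N) {k l : ℕ} {y z : ℝ} (hy : y ∈ Ico (0:ℝ) 1)
    (hz : z ∈ Ico (0:ℝ) 1) : gaussBranch N k y = gaussBranch N l z ↔ k = l ∧ y = z := by
  constructor
  · intro h
    have hN' : (N:ℝ) ≠ 0 := by exact_mod_cast hN.ne'
    have h1 := gaussBranch_denom_pos hN k hy.1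
    have h2 := gaussBranch_denom_pos hN l hz.1
    rw [gaussBranch, gaussBranch, div_eq_div_iff h1.ne' h2.ne'] at h
    have h3 := mul_left_cancel₀ hN' h
    have hkl : k = l := by
      apply le_antisymm <;> apply Nat.lt_succ_iff.1 <;> rw [← Nat.cast_lt (α := ℝ)] <;>
        push_cast <;> linarith [hy.1, hy.2, hz.1, hz.2]
    subst hkl
    exact ⟨rfl, by linarith⟩
  · rintro ⟨rfl, rfl⟩
    rfl

/-- Up to the endpoints, the preimage under `gaussT N` is the union of the branch images. -/
theorem gaussT_preimage_ae_eq {N : ℕ} (hN : 0 < N) {A : Set ℝ} (hA : A ⊆ Ico (0:ℝ) 1) :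
    (gaussT N ⁻¹' A ∩ Ico (0:ℝ) 1 : Set ℝ) =ᵐ[volume] ⋃ k : ℕ, gaussBranch N k '' A := by
  have hN' : (0:ℝ) < N := by exact_mod_cast hN
  filter_upwards [Measure.ae_ne volume (0:ℝ), Measure.ae_ne volume (1:ℝ)] with x hx0 hx1
  apply propext
  change x ∈ (gaussT N ⁻¹' A ∩ Ico (0:ℝ) 1 : Set ℝ) ↔ x ∈ ⋃ k : ℕ, gaussBranch N k '' A
  simp only [mem_inter_iff, mem_preimage, gaussT, if_neg hx0, mem_iUnion, mem_image]
  constructor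
  · rintro ⟨hxA, hx⟩
    have hxpos : 0 < x := lt_of_le_of_ne hx.1 (Ne.symm hx0)
    have hfl : (N:ℤ) ≤ ⌊(N:ℝ) / x⌋ := by
      rw [Int.le_floor, Int.cast_natCast, le_div_iff₀ hxpos]
      nlinarith [hx.2]
    obtain ⟨k, hk⟩ := Int.le.dest hfl
    refine ⟨k, _, hxA, ?_⟩
    have h : (N:ℝ) + k + Int.fract ((N:ℝ) / x) = N / x := by
      have hadd := Int.floor_add_fract ((N:ℝ) / x)
      rw [← hk] at hadd
      exact_mod_cast hadd
    rw [gaussBranch, h, div_div_cancel₀ hN'.ne']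
  · rintro ⟨k, y, hy, rfl⟩
    have hpos := gaussBranch_denom_pos hN k (hA hy).1
    have hfr : Int.fract ((N:ℝ) / gaussBranch N k y) = y := by
      rw [gaussBranch, div_div_cancel₀ hN'.ne']
      exact Int.fract_eq_iff.2 ⟨(hA hy).1, (hA hy).2, N + k, by push_cast; ring⟩
    refine ⟨by rwa [hfr], (div_pos hN' hpos).le, lt_of_le_of_ne ?_ hx1⟩
    rw [gaussBranch, div_le_one hpos]
    linarith [(hA hy).1, (Nat.cast_nonneg k : (0:ℝ) ≤ k)]

theorem hasSum_one_div_mul_succ {a : ℝ} (ha : 0 < a) :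
    HasSum (fun k : ℕ => 1 / ((a + k) * (a + k + 1))) (1 / a) := by
  rw [hasSum_iff_tendsto_nat_of_nonneg (fun k => by positivity)]
  have hsum (n : ℕ) : ∑ k ∈ Finset.range n, 1 / ((a + k) * (a + k + 1)) = 1 / a - 1 / (a + n) := by
    induction n with
    | zero => simp
    | succ n ih =>
      rw [Finset.sum_range_succ, ih]
      push_cast
      have h1 : a + n ≠ 0 := by positivity
      have h2 : a + n + 1 ≠ 0 := by positivity
      have h3 : a + (n + 1) ≠ 0 := by positivity
      field_simp
      ring
  simp only [hsum]
  have h : Tendsto (fun n : ℕ => 1 / (a + n)) atTop (nhds 0) := by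
    simp only [one_div]
    exact (tendsto_atTop_add_const_left _ a tendsto_natCast_atTop_atTop).inv_tendsto_atTop
  simpa using h.const_sub (1 / a)

theorem abs_deriv_gaussBranch_mul_density {N : ℕ} (hN : 0 < N) (c : ℝ) (k : ℕ) {y : ℝ}
    (hy : 0 ≤ y) :
    |-N / (N + k + y) ^ 2| * (1 / (c * (N + gaussBranch N k y))) =
      1 / c * (1 / ((N + y + k) * (N + y + k + 1))) := by
  have hN' : (0:ℝ) < N := by exact_mod_cast hN
  have h := gaussBranch_denom_pos hN k hy
  have h' : (0:ℝ) < N + y + k := by linarith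
  have e : (N:ℝ) + k + y = N + y + k := by ring
  rw [abs_div, abs_neg, abs_of_pos hN', abs_of_pos (by positivity), gaussBranch, e]
  rcases eq_or_ne c 0 with rfl | hc
  · simp
  · have : (N:ℝ) + N / (N + y + k) = N * (N + y + k + 1) / (N + y + k) := by field_simp
    rw [this]
    field_simp

/-- `μ_N` is invariant under `T_N`. -/
theorem gaussMu_invariant (N : ℕ) (hN : 0 < N)
    (A : Set ℝ) (hA : MeasurableSet A) (hA' : A ⊆ Set.Ico (0:ℝ) 1) :
    gaussMu N (gaussT N ⁻¹' A) = gaussMu N A := by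
  have hN' : (0:ℝ) < N := by exact_mod_cast hN
  have hinj (k : ℕ) : InjOn (gaussBranch N k) A := fun y hy z hz h =>
    ((gaussBranch_eq_iff hN (hA' hy) (hA' hz)).1 h).2
  have hderiv (k : ℕ) (y : ℝ) (hy : y ∈ A) :
      HasDerivWithinAt (gaussBranch N k) (-N / (N + k + y) ^ 2) A y :=
    (hasDerivAt_gaussBranch hN k (hA' hy).1).hasDerivWithinAt
  have hmeas (k : ℕ) : MeasurableSet (gaussBranch N k '' A) :=
    hA.image_of_continuousOn_injOn (fun y hy => (hderiv k y hy).continuousWithinAt) (hinj k)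
  have hdisj : Pairwise (Function.onFun Disjoint fun k : ℕ => gaussBranch N k '' A) := by
    intro k l hkl
    refine Set.disjoint_left.2 ?_
    rintro _ ⟨y, hy, rfl⟩ ⟨z, hz, h⟩
    exact hkl ((gaussBranch_eq_iff hN (hA' hz) (hA' hy)).1 h).1.symm
  rw [gaussMu_apply, gaussMu_apply, inter_eq_left.2 hA',
    Measure.restrict_congr_set (gaussT_preimage_ae_eq hN hA'), lintegral_iUnion hmeas hdisj]
  set c : ℝ := Real.log (N + 1) - Real.log N
  have hc : 0 ≤ c := sub_nonneg.2 (Real.log_le_log hN' (by linarith))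
  have hbranch (k : ℕ) : ∫⁻ x in gaussBranch N k '' A, ENNReal.ofReal (1 / (c * (N + x))) =
      ∫⁻ y in A, ENNReal.ofReal (1 / c * (1 / ((N + y + k) * (N + y + k + 1)))) := by
    rw [lintegral_image_eq_lintegral_abs_deriv_mul hA (hderiv k) (hinj k)]
    refine setLIntegral_congr_fun hA fun y hy => ?_
    rw [← ENNReal.ofReal_mul (abs_nonneg _),
      abs_deriv_gaussBranch_mul_density hN c k (hA' hy).1]
  simp only [hbranch]
  rw [← lintegral_tsum fun k => by fun_prop]
  refine setLIntegral_congr_fun hA fun y hy => ?_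
  have hy0 : 0 ≤ y := (hA' hy).1
  have hsum := (hasSum_one_div_mul_succ (a := N + y) (by positivity)).mul_left (1 / c)
  rw [← ENNReal.ofReal_tsum_of_nonneg (fun k => by positivity) hsum.summable, hsum.tsum_eq,
    one_div_mul_one_div]
end

section
/- For every positive integer N, the measure μ_N is ergodic for T_N: if E ⊆ [0,1) is a Borel set with T_N^{-1}(E) = E and m(E) < 1, then m(E) = 0 (where m denotes Lebesgue measure). -/
open MeasureTheory Filter Set

/-- The real Möbius map `y ↦ (a y + b) / (c y + d)`. -/
noncomputable def mobius (a b c d y : ℝ) : ℝ := (a * y + b) / (c * y + d)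

theorem mobius_sub_mobius {a b c d x y : ℝ} (hx : c * x + d ≠ 0) (hy : c * y + d ≠ 0) :
    mobius a b c d x - mobius a b c d y =
      (a * d - b * c) * (x - y) / ((c * x + d) * (c * y + d)) := by
  rw [mobius, mobius, div_sub_div _ _ hx hy]
  congr 1
  ring

theorem hasDerivAt_mobius {a b c d x : ℝ} (hx : c * x + d ≠ 0) :
    HasDerivAt (mobius a b c d) ((a * d - b * c) / (c * x + d) ^ 2) x := by
  have h₁ : HasDerivAt (fun y => a * y + b) a x := by
    simpa using ((hasDerivAt_id x).const_mul a).add_const b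
  have h₂ : HasDerivAt (fun y => c * y + d) c x := by
    simpa using ((hasDerivAt_id x).const_mul c).add_const d
  exact (h₁.fun_div h₂ hx).congr_deriv (by congr 1; ring)

/-- A Möbius map with `0 ≤ c ≤ d` maps `[0, 1]` into the closed ball around the midpoint of the
images of `0` and `1`. -/
theorem mobius_mem_closedBall {a b c d y : ℝ} (hc : 0 ≤ c) (hd : 0 < d) (hy : y ∈ Icc (0 : ℝ) 1) :
    mobius a b c d y ∈ Metric.closedBall ((mobius a b c d 0 + mobius a b c d 1) / 2)
      (|a * d - b * c| / (d * (c + d)) / 2) := by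
  obtain ⟨hy₀, hy₁⟩ := hy
  have hcy : 0 < c * y + d := by positivity
  have hcd : 0 < c + d := by positivity
  have h₀ := mobius_sub_mobius (a := a) (b := b) (c := c) (d := d) (x := y) (y := 0) hcy.ne'
    (by simpa using hd.ne')
  have h₁ := mobius_sub_mobius (a := a) (b := b) (c := c) (d := d) (x := y) (y := 1) hcy.ne'
    (by simpa using hcd.ne')
  have h₀₁ := mobius_sub_mobius (a := a) (b := b) (c := c) (d := d) (x := 1) (y := 0)
    (by simpa using hcd.ne') (by simpa using hd.ne')
  have hprod : (mobius a b c d y - mobius a b c d 0) * (mobius a b c d y - mobius a b c d 1)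
      ≤ 0 := by
    have : (mobius a b c d y - mobius a b c d 0) * (mobius a b c d y - mobius a b c d 1) =
        -((a * d - b * c) ^ 2 * y * (1 - y) / ((c * y + d) ^ 2 * d * (c + d))) := by
      rw [h₀, h₁]
      simp only [mul_zero, zero_add, mul_one]
      field_simp
      ring
    rw [this, neg_nonpos]
    have := sub_nonneg.2 hy₁
    positivity
  have hr : |a * d - b * c| / (d * (c + d)) = |mobius a b c d 1 - mobius a b c d 0| := by
    rw [h₀₁, abs_div, abs_of_pos (a := (c * 1 + d) * (c * 0 + d)) (by simpa using by positivity)]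
    congr 1 <;> ring_nf
  rw [Metric.mem_closedBall, Real.dist_eq, hr]
  refine abs_le_of_sq_le_sq ?_ (by positivity)
  rw [div_pow, sq_abs]
  nlinarith

/-- Bounded distortion: the image of a measurable subset of `(0, 1)` under a Möbius map with
`0 ≤ c ≤ d` occupies at least half of its share of the image of `(0, 1)`. -/
theorem mul_volume_le_volume_mobius_image {a b c d : ℝ} (hc : 0 ≤ c) (hcd : c ≤ d) (hd : 0 < d)
    (hdet : a * d - b * c ≠ 0) {A : Set ℝ} (hA : MeasurableSet A) (hA₁ : A ⊆ Ioo 0 1) :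
    ENNReal.ofReal (|a * d - b * c| / (d * (c + d))) * (volume A / 2) ≤
      volume (mobius a b c d '' A) := by
  have hpos : ∀ x ∈ A, 0 < c * x + d := fun x hx => by
    have := (hA₁ hx).1
    positivity
  have hinj : InjOn (mobius a b c d) A := fun x hx y hy hxy => by
    have h := mobius_sub_mobius (a := a) (b := b) (hpos x hx).ne' (hpos y hy).ne'
    rw [hxy, sub_self, eq_comm, div_eq_zero_iff] at h
    have := (mul_pos (hpos x hx) (hpos y hy)).ne'
    have := sub_eq_zero.1 ((mul_eq_zero.1 (h.resolve_right this)).resolve_left hdet)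
    exact this
  have himage := lintegral_image_eq_lintegral_abs_deriv_mul hA
    (fun x hx => (hasDerivAt_mobius (a := a) (b := b) (hpos x hx).ne').hasDerivWithinAt) hinj 1
  simp only [Pi.one_apply, mul_one, setLIntegral_one] at himage
  rw [himage]
  calc ENNReal.ofReal (|a * d - b * c| / (d * (c + d))) * (volume A / 2)
      = ENNReal.ofReal (|a * d - b * c| / (d * (c + d)) / 2) * volume A := by
        rw [ENNReal.ofReal_div_of_pos two_pos, ENNReal.ofReal_ofNat, ENNReal.mul_comm_div]
    _ = ∫⁻ _ in A, ENNReal.ofReal (|a * d - b * c| / (d * (c + d)) / 2) := by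
        rw [setLIntegral_const]
    _ ≤ ∫⁻ x in A, ENNReal.ofReal |(a * d - b * c) / (c * x + d) ^ 2| := by
        refine setLIntegral_mono' hA fun x hx => ENNReal.ofReal_le_ofReal ?_
        have hx₀ := hpos x hx
        have hx₁ : c * x ≤ c := mul_le_of_le_one_right hc (hA₁ hx).2.le
        rw [abs_div, abs_of_pos (pow_pos hx₀ 2), div_div]
        gcongr
        nlinarith

/-- The map `(a y + b) / (c y + d)` is an inverse branch of order `n` for `T_N` whose image of
`(0, 1)` contains `x`; membership in the invariant set `E` is preserved. The bound on the
determinant says that the image of `(0, 1)` has length at most `2⁻ⁿ`. -/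
structure IsInverseBranch (E : Set ℝ) (x : ℝ) (n : ℕ) (a b c d : ℝ) : Prop where
  nonneg : 0 ≤ c
  le : c ≤ d
  pos : 0 < d
  det_ne_zero : a * d - b * c ≠ 0
  det_le : |a * d - b * c| * 2 ^ n ≤ d * (c + d)
  exists_irrational : ∃ t ∈ Ioo (0 : ℝ) 1, Irrational t ∧ mobius a b c d t = x
  mem_iff : ∀ y ∈ Ioo (0 : ℝ) 1, mobius a b c d y ∈ E ↔ y ∈ E

theorem inverseBranch_mem_Ioo_and_mem_iff {N : ℕ} {E : Set ℝ}
    (hinv : Ico (0 : ℝ) 1 ∩ gaussT N ⁻¹' E = E)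
    {k : ℤ} (hk : (N : ℤ) ≤ k) (hN : 0 < N) {y : ℝ} (hy : y ∈ Ioo (0 : ℝ) 1) :
    N / (k + y) ∈ Ioo (0 : ℝ) 1 ∧ ((N / (k + y) : ℝ) ∈ E ↔ y ∈ E) := by
  have hN' : (0 : ℝ) < N := by exact_mod_cast hN
  have hk' : (N : ℝ) ≤ k := by exact_mod_cast hk
  have hky : (0 : ℝ) < k + y := by linarith [hy.1]
  have hpos : (0 : ℝ) < N / (k + y) := by positivity
  have hlt : (N / (k + y) : ℝ) < 1 := by
    rw [div_lt_one hky]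
    linarith [hy.1]
  refine ⟨⟨hpos, hlt⟩, ?_⟩
  have hT : gaussT N (N / (k + y)) = y := by
    rw [gaussT, if_neg hpos.ne', div_div_cancel₀ hN'.ne', Int.fract_intCast_add,
      Int.fract_eq_self.2 ⟨hy.1.le, hy.2⟩]
  constructor
  · intro h
    rw [← hinv] at h
    simpa [hT] using h.2
  · intro h
    rw [← hinv]
    exact ⟨⟨hpos.le, hlt⟩, by simpa [hT] using h⟩

theorem IsInverseBranch.exists_succ {N : ℕ} {E : Set ℝ}
    (hinv : Ico (0 : ℝ) 1 ∩ gaussT N ⁻¹' E = E) (hN : 0 < N) {x : ℝ} {n : ℕ} {a b c d : ℝ}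
    (h : IsInverseBranch E x n a b c d) :
    ∃ a' b' c' d', IsInverseBranch E x (n + 1) a' b' c' d' := by
  obtain ⟨t, ⟨ht₀, ht₁⟩, htirr, htx⟩ := h.exists_irrational
  have hc := h.nonneg
  have hcd := h.le
  have hd := h.pos
  have hN' : (1 : ℝ) ≤ N := by exact_mod_cast hN
  set k : ℤ := ⌊(N : ℝ) / t⌋ with hkdef
  have hk : (N : ℤ) ≤ k := by
    rw [hkdef, Int.le_floor, le_div_iff₀ ht₀]
    push_cast
    nlinarith
  have hk' : (N : ℝ) ≤ k := by exact_mod_cast hk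
  have hcomp : ∀ y ∈ Ioo (0 : ℝ) 1,
      mobius b (a * N + b * k) d (c * N + d * k) y = mobius a b c d (N / (k + y)) := by
    intro y hy
    have : (0 : ℝ) < k + y := by linarith [hy.1]
    have h₁ : 0 < c * (N / (k + y)) + d := by positivity
    have h₂ : 0 < d * y + (c * N + d * k) := by
      have := hy.1
      have : (0 : ℝ) < k := by linarith
      positivity
    unfold mobius
    rw [div_eq_div_iff h₂.ne' h₁.ne']
    field_simp
    ring
  have hfirr : Irrational (Int.fract ((N : ℝ) / t)) := by
    rw [Int.fract]
    exact (htirr.natCast_div hN.ne').sub_intCast _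
  have hfmem : Int.fract ((N : ℝ) / t) ∈ Ioo (0 : ℝ) 1 :=
    ⟨(Int.fract_nonneg _).lt_of_ne hfirr.ne_zero.symm, Int.fract_lt_one _⟩
  have hdet : b * (c * N + d * k) - (a * N + b * k) * d = -(N * (a * d - b * c)) := by ring
  refine ⟨b, a * N + b * k, d, c * N + d * k, hd.le, ?_, ?_, ?_, ?_, ?_, ?_⟩
  · nlinarith [mul_nonneg hc (zero_le_one.trans hN')]
  · have : (0 : ℝ) < k := by linarith
    positivity
  · rw [hdet]
    exact neg_ne_zero.2 (mul_ne_zero (by positivity) h.det_ne_zero)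
  · rw [hdet, abs_neg, abs_mul, abs_of_pos (a := (N : ℝ)) (by positivity)]
    have hdk : (c + d) * N ≤ c * N + d * k := by nlinarith
    have h2d : 2 * d ≤ d + (c * N + d * k) := by nlinarith
    calc (N : ℝ) * |a * d - b * c| * 2 ^ (n + 1) = 2 * N * (|a * d - b * c| * 2 ^ n) := by ring
      _ ≤ 2 * N * (d * (c + d)) := by exact mul_le_mul_of_nonneg_left h.det_le (by positivity)
      _ = ((c + d) * N) * (2 * d) := by ring
      _ ≤ (c * N + d * k) * (d + (c * N + d * k)) := by gcongr
  · refine ⟨_, hfmem, hfirr, ?_⟩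
    rw [hcomp _ hfmem, hkdef, Int.floor_add_fract, div_div_cancel₀ (by positivity), htx]
  · intro y hy
    obtain ⟨hmem, hiff⟩ := inverseBranch_mem_Ioo_and_mem_iff hinv hk hN hy
    rw [hcomp y hy, h.mem_iff _ hmem, hiff]

theorem exists_isInverseBranch {N : ℕ} {E : Set ℝ}
    (hinv : Ico (0 : ℝ) 1 ∩ gaussT N ⁻¹' E = E) (hN : 0 < N) {x : ℝ} (hx : x ∈ Ioo (0 : ℝ) 1)
    (hirr : Irrational x) (n : ℕ) : ∃ a b c d, IsInverseBranch E x n a b c d := by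
  induction n with
  | zero =>
    refine ⟨1, 0, 0, 1, le_rfl, zero_le_one, one_pos, by simp, by simp, ⟨x, hx, hirr, ?_⟩, ?_⟩
    · simp [mobius]
    · simp [mobius]
  | succ n ih =>
    obtain ⟨a, b, c, d, h⟩ := ih
    exact h.exists_succ hinv hN

/-- Around any point with an inverse branch of order `n` there is a ball of radius at most `2⁻ⁿ`
in which the complement of `E` misses a fixed proportion of the volume. -/
theorem IsInverseBranch.exists_closedBall {E : Set ℝ} (hE : MeasurableSet E) {x : ℝ} {n : ℕ}
    {a b c d : ℝ} (h : IsInverseBranch E x n a b c d) :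
    ∃ w r : ℝ, 0 < r ∧ r ≤ (1 / 2) ^ n ∧ x ∈ Metric.closedBall w r ∧
      volume (Eᶜ ∩ Metric.closedBall w r) / volume (Metric.closedBall w r) +
        volume (E ∩ Ioo 0 1) / 2 ≤ 1 := by
  have hd := h.pos
  have hc := h.nonneg
  have hdet := abs_pos.2 h.det_ne_zero
  set r := |a * d - b * c| / (d * (c + d)) / 2 with hr
  set w := (mobius a b c d 0 + mobius a b c d 1) / 2
  have hrpos : 0 < r := by positivity
  have hmem : ∀ y ∈ Ioo (0 : ℝ) 1, mobius a b c d y ∈ Metric.closedBall w r := fun y hy =>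
    mobius_mem_closedBall hc hd (Ioo_subset_Icc_self hy)
  refine ⟨w, r, hrpos, ?_, ?_, ?_⟩
  · have : |a * d - b * c| / (d * (c + d)) ≤ (1 / 2) ^ n := by
      rw [div_le_iff₀ (by positivity), one_div, inv_pow, inv_mul_eq_div, le_div_iff₀ (by positivity)]
      exact h.det_le
    have : 0 < |a * d - b * c| / (d * (c + d)) := by positivity
    linarith
  · obtain ⟨t, ht, -, rfl⟩ := h.exists_irrational
    exact hmem t ht
  · have hvol : volume (Metric.closedBall w r) =
        ENNReal.ofReal (|a * d - b * c| / (d * (c + d))) := by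
      rw [Real.volume_closedBall, hr]
      congr 1
      ring
    have hvol₀ : volume (Metric.closedBall w r) ≠ 0 :=
      (Metric.measure_closedBall_pos volume w hrpos).ne'
    have hvol₁ : volume (Metric.closedBall w r) ≠ ⊤ := measure_closedBall_lt_top.ne
    have himage : volume (Metric.closedBall w r) * (volume (E ∩ Ioo 0 1) / 2) ≤
        volume (Metric.closedBall w r ∩ E) := by
      rw [hvol]
      refine (mul_volume_le_volume_mobius_image hc h.le hd h.det_ne_zero
        (hE.inter measurableSet_Ioo) inter_subset_right).trans (measure_mono ?_)
      rintro _ ⟨y, ⟨hyE, hy⟩, rfl⟩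
      exact ⟨hmem y hy, (h.mem_iff y hy).2 hyE⟩
    have hsplit := measure_inter_add_sdiff (μ := volume) (Metric.closedBall w r) hE
    rw [sdiff_eq, inter_comm _ Eᶜ] at hsplit
    rw [← ENNReal.mul_le_mul_iff_right hvol₀ hvol₁, mul_add, ENNReal.mul_div_cancel hvol₀ hvol₁,
      mul_one, add_comm]
    exact (add_le_add_left himage _).trans hsplit.le

/-- Ergodicity of `μ_N` (equivalently, of Lebesgue measure) for `T_N`:
any Borel set `E ⊆ [0,1)` invariant under `T_N` with Lebesgue measure
less than `1` has Lebesgue measure `0`. -/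
theorem gaussT_ergodic (N : ℕ) (hN : 0 < N)
    (E : Set ℝ) (hE : MeasurableSet E) (hEsub : E ⊆ Set.Ico (0:ℝ) 1)
    (hinv : Set.Ico (0:ℝ) 1 ∩ gaussT N ⁻¹' E = E)
    (hlt : volume E < 1) :
    volume E = 0 := by
  have hirr : ∀ᵐ x : ℝ, Irrational x := (countable_range ((↑) : ℚ → ℝ)).ae_notMem volume
  have hdensity := (ae_restrict_iff' hE.compl).1
    (IsUnifLocDoublingMeasure.ae_tendsto_measure_inter_div (volume : Measure ℝ) Eᶜ 1)
  obtain ⟨x, hx, hxE, hxirr, hxd⟩ : ∃ x ∈ Ioo (0 : ℝ) 1, x ∉ E ∧ Irrational x ∧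
      ∀ (w δ : ℕ → ℝ), Tendsto δ atTop (nhdsWithin 0 (Ioi 0)) →
        (∀ᶠ j in atTop, x ∈ Metric.closedBall (w j) (1 * δ j)) →
        Tendsto (fun j => volume (Eᶜ ∩ Metric.closedBall (w j) (δ j)) /
          volume (Metric.closedBall (w j) (δ j))) atTop (nhds 1) := by
    by_contra! hcon
    refine hlt.not_ge ?_
    calc (1 : ENNReal) = volume (Ioo (0 : ℝ) 1) := by simp
      _ ≤ volume E := by
        refine measure_mono_ae ?_
        filter_upwards [hirr, hdensity] with x hxirr hxd hx
        by_contra hxE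
        obtain ⟨w, δ, hδ, hw, hnot⟩ := hcon x hx hxE hxirr
        exact hnot (hxd hxE w δ hδ hw)
  choose a b c d hbranch using exists_isInverseBranch hinv hN hx hxirr
  choose w δ hδpos hδle hmem hvol using fun n => (hbranch n).exists_closedBall hE
  have hδ : Tendsto δ atTop (nhdsWithin 0 (Ioi 0)) := by
    refine tendsto_nhdsWithin_iff.2 ⟨?_, Eventually.of_forall hδpos⟩
    exact squeeze_zero (fun n => (hδpos n).le) hδle
      (tendsto_pow_atTop_nhds_zero_of_lt_one (by norm_num) (by norm_num))
  have hlim := hxd w δ hδ (Eventually.of_forall fun n => by simpa only [one_mul] using hmem n)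
  have hle : 1 + volume (E ∩ Ioo 0 1) / 2 ≤ 1 :=
    le_of_tendsto (hlim.add tendsto_const_nhds) (Eventually.of_forall hvol)
  have hzero : volume (E ∩ Ioo 0 1) = 0 := by
    have h : volume (E ∩ Ioo 0 1) / 2 = 0 := by
      simpa using (ENNReal.add_le_add_iff_left ENNReal.one_ne_top).1
        (hle.trans_eq (add_zero 1).symm)
    simpa [ENNReal.div_eq_zero_iff] using h
  rw [← nonpos_iff_eq_zero, ← hzero]
  refine measure_mono_ae ?_
  filter_upwards [hirr] with y hy hyE
  exact ⟨hyE, (hEsub hyE).1.lt_of_ne hy.ne_zero.symm, (hEsub hyE).2⟩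
end

section
/- For every positive integer N, for Lebesgue almost every x ∈ [0,1) with N-continued fraction coefficients (a_k), the arithmetic mean of the coefficients diverges: lim_{n→∞} (1/n) Σ_{k=1}^n a_k = ∞. -/
open MeasureTheory Filter Set

/-- The exponential of minus the truncated, normalised first coefficient of `x`. -/
noncomputable def gaussWeight (N J : ℕ) (x : ℝ) : ℝ :=
  Real.exp (-(min ((⌊(N : ℝ) / x⌋ : ℝ) - N) J / J))

theorem measurable_gaussT (N : ℕ) : Measurable (gaussT N) := by
  unfold gaussT
  exact Measurable.ite (measurableSet_singleton 0) measurable_const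
    (measurable_const.div measurable_id).fract

theorem measurable_gaussWeight (N J : ℕ) : Measurable (gaussWeight N J) := by
  unfold gaussWeight
  have h : Measurable fun x : ℝ => ((⌊(N : ℝ) / x⌋ : ℤ) : ℝ) :=
    (measurable_from_top (f := fun z : ℤ => (z : ℝ))).comp
      (measurable_const.div measurable_id).floor
  exact Real.measurable_exp.comp (((h.sub_const _).min measurable_const).div_const _).neg

theorem exp_neg_le_one_sub_half {u : ℝ} (h0 : 0 ≤ u) (h1 : u ≤ 1) :
    Real.exp (-u) ≤ 1 - u / 2 := by
  rw [Real.exp_neg]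
  have h2 := Real.quadratic_le_exp_of_nonneg h0
  rw [inv_le_comm₀ (Real.exp_pos _) (by linarith)]
  refine le_trans ?_ h2
  rw [inv_le_iff_one_le_mul₀ (by linarith)]
  nlinarith [mul_nonneg h0 (sub_nonneg.2 h1), mul_nonneg h0 (mul_nonneg h0 (sub_nonneg.2 h1))]

/-- Summation by parts against the truncated linear weight `1 - min i J / (2J)`. -/
theorem sum_trunc_mul_sub (u : ℕ → ℝ) {J : ℕ} (hJ : 0 < J) (n : ℕ) :
    ∑ i ∈ Finset.range (J + n), (1 - min (i : ℝ) J / J / 2) * (u i - u (i + 1)) =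
      u 0 - (∑ i ∈ Finset.range J, u (i + 1)) / (2 * J) - u (J + n) / 2 := by
  have hJ' : (J : ℝ) ≠ 0 := by positivity
  have start : ∀ m ≤ J, ∑ i ∈ Finset.range m, (1 - min (i : ℝ) J / J / 2) * (u i - u (i + 1)) =
      u 0 - (∑ i ∈ Finset.range m, u (i + 1)) / (2 * J) - (1 - m / (2 * J)) * u m := by
    intro m
    induction m with
    | zero => intro _; simp
    | succ m ih =>
      intro hm
      rw [Finset.sum_range_succ, ih (by omega), Finset.sum_range_succ,
        min_eq_left (by exact_mod_cast (by omega : m ≤ J))]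
      push_cast
      field_simp
      ring
  induction n with
  | zero =>
    rw [add_zero, start J le_rfl]
    field_simp
    ring
  | succ n ih =>
    rw [← add_assoc, Finset.sum_range_succ, ih,
      min_eq_right (by push_cast; linarith [n.cast_nonneg (α := ℝ)])]
    field_simp
    ring

/-- The contraction factor of the weighted transfer operator. -/
noncomputable def gaussRate (J : ℕ) : ℝ :=
  1 - (∑ i ∈ Finset.range J, 1 / ((i : ℝ) + 3)) / (2 * J)

theorem gaussRate_nonneg (J : ℕ) : 0 ≤ gaussRate J := by
  unfold gaussRate
  rcases J.eq_zero_or_pos with rfl | hJ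
  · simp
  have h : ∑ i ∈ Finset.range J, 1 / ((i : ℝ) + 3) ≤ ∑ i ∈ Finset.range J, (1 : ℝ) := by
    refine Finset.sum_le_sum fun i _ => ?_
    rw [div_le_one (by positivity)]
    linarith [i.cast_nonneg (α := ℝ)]
  simp only [Finset.sum_const, Finset.card_range, nsmul_eq_mul, mul_one] at h
  rw [sub_nonneg, div_le_one (by positivity)]
  linarith [J.cast_nonneg (α := ℝ)]

theorem sum_branch_mass_le {N J : ℕ} (hN : 0 < N) (hJ : 0 < J) {r : ℝ} (h0 : 0 ≤ r) (h1 : r ≤ 1)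
    (n : ℕ) :
    ∑ i ∈ Finset.range n, Real.exp (-(min (i : ℝ) J / J)) *
      (N / (N + i + r * N) ^ 2 / (1 + (N + i + r * N)⁻¹)) ≤ gaussRate J / (1 + r) := by
  have hNp : (0 : ℝ) < N := by exact_mod_cast hN
  have hN1 : (1 : ℝ) ≤ N := by exact_mod_cast hN
  have hJp : (0 : ℝ) < J := by exact_mod_cast hJ
  set u : ℕ → ℝ := fun i => N / (N + i + r * N) with hu
  have hup : ∀ i, 0 ≤ u i := fun i => by positivity
  have key : ∀ i : ℕ, N / (N + i + r * N) ^ 2 / (1 + (N + i + r * N)⁻¹) = u i - u (i + 1) := by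
    intro i
    have : 0 < N + i + r * N := by positivity
    have h3 : 0 < N + (i + 1) + r * N := by positivity
    simp only [hu]
    push_cast
    field_simp
    ring
  calc
    _ ≤ ∑ i ∈ Finset.range (J + n), Real.exp (-(min (i : ℝ) J / J)) *
      (N / (N + i + r * N) ^ 2 / (1 + (N + i + r * N)⁻¹)) :=
        Finset.sum_le_sum_of_subset_of_nonneg
          (Finset.range_mono (by omega)) (fun i _ _ => by positivity)
    _ ≤ ∑ i ∈ Finset.range (J + n), (1 - min (i : ℝ) J / J / 2) * (u i - u (i + 1)) := by
        refine Finset.sum_le_sum fun i _ => ?_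
        rw [← key]
        refine mul_le_mul_of_nonneg_right (exp_neg_le_one_sub_half (by positivity) ?_)
          (by positivity)
        rw [div_le_one hJp]
        exact min_le_right _ _
    _ ≤ u 0 - (∑ i ∈ Finset.range J, u (i + 1)) / (2 * J) := by
        rw [sum_trunc_mul_sub u hJ]
        linarith [hup (J + n)]
    _ ≤ 1 / (1 + r) - (∑ i ∈ Finset.range J, 1 / ((i : ℝ) + 3)) / (2 * J) := by
        have e : u 0 = 1 / (1 + r) := by
          simp only [hu]
          push_cast
          field_simp
          ring
        rw [e]
        gcongr with i
        simp only [hu]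
        rw [div_le_div_iff₀ (by positivity) (by positivity)]
        push_cast
        nlinarith [mul_nonneg (sub_nonneg.2 h1) hNp.le,
          mul_nonneg (sub_nonneg.2 hN1) (i.cast_nonneg (α := ℝ))]
    _ ≤ gaussRate J / (1 + r) := by
        unfold gaussRate
        rw [sub_div]
        refine sub_le_sub_left ?_ _
        exact div_le_self (by positivity) (by linarith)

theorem gaussT_branch {N : ℕ} (hN : 0 < N) (i : ℕ) {y : ℝ} (hy : y ∈ Ico (0 : ℝ) 1) :
    gaussT N (N / (N + i + y)) = y := by
  have hNp : (0 : ℝ) < N := by exact_mod_cast hN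
  have h : (0 : ℝ) < N + i + y := by linarith [hy.1, i.cast_nonneg (α := ℝ)]
  rw [gaussT, if_neg (by positivity), div_div_cancel₀ hNp.ne', Int.fract_eq_iff]
  exact ⟨hy.1, hy.2, N + i, by push_cast; ring⟩

theorem gaussWeight_branch {N : ℕ} (hN : 0 < N) (J i : ℕ) {y : ℝ} (hy : y ∈ Ico (0 : ℝ) 1) :
    gaussWeight N J (N / (N + i + y)) = Real.exp (-(min (i : ℝ) J / J)) := by
  have hNp : (0 : ℝ) < N := by exact_mod_cast hN
  have h : ⌊(N : ℝ) + i + y⌋ = N + i := by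
    rw [Int.floor_eq_iff]
    push_cast
    constructor <;> linarith [hy.1, hy.2]
  rw [gaussWeight, div_div_cancel₀ hNp.ne', h]
  push_cast
  rw [add_sub_cancel_left]

theorem Ioo_subset_iUnion_branch {N : ℕ} (hN : 0 < N) :
    Ioo (0 : ℝ) 1 ⊆ ⋃ i : ℕ, (fun y : ℝ => (N : ℝ) / (N + i + y)) '' Ico 0 1 := by
  intro x hx
  have hNp : (0 : ℝ) < N := by exact_mod_cast hN
  have h : (N : ℤ) ≤ ⌊(N : ℝ) / x⌋ := by
    rw [Int.le_floor, le_div_iff₀ hx.1]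
    push_cast
    nlinarith [hx.2]
  obtain ⟨i, hi⟩ := Int.le.dest h
  refine mem_iUnion.2 ⟨i, Int.fract ((N : ℝ) / x), ⟨Int.fract_nonneg _, Int.fract_lt_one _⟩, ?_⟩
  have hi' : (N : ℝ) + i = ⌊(N : ℝ) / x⌋ := by exact_mod_cast hi
  simp only
  rw [hi', Int.floor_add_fract, div_div_cancel₀ hNp.ne']

/-- The exponential moment of the truncated coefficient sum, against a Möbius density, decays
geometrically. -/
theorem lintegral_prod_gaussWeight_le {N J : ℕ} (hN : 0 < N) (hJ : 0 < J) (n : ℕ) :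
    ∀ r : ℝ, 0 ≤ r → r ≤ 1 →
      ∫⁻ x in Ico (0 : ℝ) 1, ENNReal.ofReal
        ((∏ k ∈ Finset.range n, gaussWeight N J ((gaussT N)^[k] x)) / (1 + r * x) ^ 2) ≤
      ENNReal.ofReal (2 * gaussRate J ^ n / (1 + r)) := by
  have hNp : (0 : ℝ) < N := by exact_mod_cast hN
  have hN1 : (1 : ℝ) ≤ N := by exact_mod_cast hN
  induction n with
  | zero =>
    intro r h0 h1
    calc
      _ ≤ ∫⁻ x in Ico (0 : ℝ) 1, 1 := by
        refine setLIntegral_mono' measurableSet_Ico fun x hx => ?_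
        rw [ENNReal.ofReal_le_one, Finset.range_zero, Finset.prod_empty]
        have := mul_nonneg h0 hx.1
        exact div_le_one_of_le₀ (one_le_pow₀ (by linarith)) (by positivity)
      _ ≤ _ := by
        rw [setLIntegral_const, Real.volume_Ico, one_mul]
        refine ENNReal.ofReal_le_ofReal ?_
        rw [le_div_iff₀ (by linarith)]
        linarith
  | succ n ih =>
    intro r h0 h1
    set G : ℝ → ℝ := fun x => ∏ k ∈ Finset.range n, gaussWeight N J ((gaussT N)^[k] x)
    have hGs : ∀ x, ∏ k ∈ Finset.range (n + 1), gaussWeight N J ((gaussT N)^[k] x) =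
        gaussWeight N J x * G (gaussT N x) := by
      intro x
      rw [Finset.prod_range_succ', mul_comm]
      rfl
    simp only [hGs]
    have branch : ∀ i : ℕ,
        ∫⁻ x in (fun y : ℝ => (N : ℝ) / (N + i + y)) '' Ico 0 1, ENNReal.ofReal
          (gaussWeight N J x * G (gaussT N x) / (1 + r * x) ^ 2) ≤
        ENNReal.ofReal (2 * gaussRate J ^ n * (Real.exp (-(min (i : ℝ) J / J)) *
          (N / (N + i + r * N) ^ 2 / (1 + (N + i + r * N)⁻¹)))) := by
      intro i
      have hden : ∀ y ∈ Ico (0 : ℝ) 1, (0 : ℝ) < N + i + y := fun y hy => by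
        linarith [hy.1, i.cast_nonneg (α := ℝ)]
      have hs : 0 < N + i + r * N := by positivity
      rw [lintegral_image_eq_lintegral_abs_deriv_mul (f' := fun y => -N / (N + i + y) ^ 2)
        measurableSet_Ico]
      · calc
          _ = ∫⁻ y in Ico (0 : ℝ) 1,
              ENNReal.ofReal (Real.exp (-(min (i : ℝ) J / J)) * (N / (N + i + r * N) ^ 2)) *
              ENNReal.ofReal (G y / (1 + (N + i + r * N)⁻¹ * y) ^ 2) := by
            refine setLIntegral_congr_fun measurableSet_Ico fun y hy => ?_
            have hd := hden y hy
            have hy0 := hy.1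
            rw [gaussT_branch hN i hy, gaussWeight_branch hN J i hy,
              ← ENNReal.ofReal_mul (abs_nonneg _), ← ENNReal.ofReal_mul (by positivity),
              neg_div, abs_neg, abs_of_nonneg (by positivity)]
            congr 1
            have e1 : 1 + r * (N / (N + i + y)) = (N + i + r * N + y) / (N + i + y) := by
              field_simp
              ring
            have e2 : 1 + (N + i + r * N)⁻¹ * y = (N + i + r * N + y) / (N + i + r * N) := by
              field_simp
            have h3 : 0 < N + i + r * N + y := by positivity
            rw [e1, e2]
            field_simp
          _ ≤ _ := by
            rw [lintegral_const_mul' _ _ ENNReal.ofReal_ne_top]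
            have hr : (N + i + r * N)⁻¹ ≤ 1 := inv_le_one_of_one_le₀ (by
              linarith [i.cast_nonneg (α := ℝ), mul_nonneg h0 hNp.le])
            refine (mul_le_mul_right (ih _ (by positivity) hr) _).trans_eq ?_
            rw [← ENNReal.ofReal_mul (by positivity)]
            congr 1
            ring
      · intro y hy
        have hd := hden y hy
        have h := (((hasDerivAt_id y).const_add ((N : ℝ) + i)).inv hd.ne').const_mul (N : ℝ)
        refine HasDerivAt.hasDerivWithinAt ?_
        simpa [div_eq_mul_inv] using h
      · intro y hy z hz h
        have h1 := hden y hy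
        have h2 := hden z hz
        simp only at h
        field_simp at h
        linarith
    calc
      _ = ∫⁻ x in Ioo (0 : ℝ) 1, ENNReal.ofReal
          (gaussWeight N J x * G (gaussT N x) / (1 + r * x) ^ 2) := by
        rw [setLIntegral_congr Ioo_ae_eq_Ico]
      _ ≤ ∑' i : ℕ, ∫⁻ x in (fun y : ℝ => (N : ℝ) / (N + i + y)) '' Ico 0 1, ENNReal.ofReal
          (gaussWeight N J x * G (gaussT N x) / (1 + r * x) ^ 2) :=
        (lintegral_mono_set (Ioo_subset_iUnion_branch hN)).trans (lintegral_iUnion_le _ _)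
      _ ≤ _ := by
        refine (ENNReal.tsum_le_tsum branch).trans (ENNReal.tsum_le_of_sum_range_le fun m => ?_)
        have hρ := gaussRate_nonneg J
        rw [← ENNReal.ofReal_sum_of_nonneg (fun i _ => by positivity), ← Finset.mul_sum]
        refine ENNReal.ofReal_le_ofReal ?_
        calc
          _ ≤ 2 * gaussRate J ^ n * (gaussRate J / (1 + r)) := by
            gcongr
            exact sum_branch_mass_le hN hJ h0 h1 m
          _ = _ := by ring

theorem exists_gaussRate_mul_exp_lt_one (M : ℕ) :
    ∃ J : ℕ, 0 < J ∧ gaussRate J * Real.exp (M / J) < 1 := by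
  have h : Tendsto (fun n : ℕ => ∑ i ∈ Finset.range n, 1 / ((i : ℝ) + 3)) atTop atTop := by
    have h1 := (not_summable_iff_tendsto_nat_atTop_of_nonneg (f := fun i : ℕ => 1 / ((i : ℝ) + 3))
      (fun i => by positivity)).1
    refine h1 fun hs => Real.not_summable_one_div_natCast ((summable_nat_add_iff 3).1 ?_)
    simpa using hs
  obtain ⟨J, hJ, hJ0⟩ := ((h.eventually_gt_atTop (2 * M : ℝ)).and (eventually_gt_atTop 0)).exists
  refine ⟨J, hJ0, ?_⟩
  have hJp : (0 : ℝ) < J := by exact_mod_cast hJ0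
  have hlt : (M : ℝ) / J < (∑ i ∈ Finset.range J, 1 / ((i : ℝ) + 3)) / (2 * J) := by
    rw [div_lt_div_iff₀ hJp (by positivity)]
    nlinarith
  have hle : gaussRate J ≤ Real.exp (-((∑ i ∈ Finset.range J, 1 / ((i : ℝ) + 3)) / (2 * J))) := by
    unfold gaussRate
    linarith [Real.add_one_le_exp (-((∑ i ∈ Finset.range J, 1 / ((i : ℝ) + 3)) / (2 * J)))]
  calc
    _ ≤ _ := mul_le_mul_of_nonneg_right hle (Real.exp_pos _).le
    _ < 1 := by
      rw [← Real.exp_add, Real.exp_lt_one_iff]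
      linarith

theorem ae_eventually_mul_lt_sum_coeff {N : ℕ} (hN : 0 < N) (M : ℕ) :
    ∀ᵐ x ∂(volume.restrict (Ico (0 : ℝ) 1)), ∀ᶠ n : ℕ in atTop,
      (M : ℝ) * n < ∑ k ∈ Finset.range n, (⌊(N : ℝ) / (gaussT N)^[k] x⌋ : ℝ) := by
  obtain ⟨J, hJ, hlt⟩ := exists_gaussRate_mul_exp_lt_one M
  have hJp : (0 : ℝ) < J := by exact_mod_cast hJ
  have hq0 : 0 ≤ gaussRate J * Real.exp (M / J) :=
    mul_nonneg (gaussRate_nonneg J) (Real.exp_pos _).le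
  set F : ℕ → ℝ → ENNReal := fun n x => ENNReal.ofReal (Real.exp (M / J) ^ n) *
    ENNReal.ofReal (∏ k ∈ Finset.range n, gaussWeight N J ((gaussT N)^[k] x)) with hF
  have hFm : ∀ n, Measurable (F n) := fun n => by
    refine (ENNReal.measurable_ofReal.comp (Finset.measurable_fun_prod _ fun k _ => ?_)).const_mul _
    exact (measurable_gaussWeight N J).comp ((measurable_gaussT N).iterate k)
  have hint : ∀ n, ∫⁻ x in Ico (0 : ℝ) 1, F n x ≤
      ENNReal.ofReal (2 * (gaussRate J * Real.exp (M / J)) ^ n) := by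
    intro n
    have h := lintegral_prod_gaussWeight_le hN hJ n 0 le_rfl zero_le_one
    simp only [zero_mul, add_zero, one_pow, div_one] at h
    simp only [hF]
    rw [lintegral_const_mul' _ _ ENNReal.ofReal_ne_top]
    refine (mul_le_mul_right h _).trans_eq ?_
    rw [← ENNReal.ofReal_mul (by positivity), mul_pow]
    congr 1
    ring
  have hfin : ∫⁻ x in Ico (0 : ℝ) 1, ∑' n, F n x ≠ ⊤ := by
    rw [lintegral_tsum fun n => (hFm n).aemeasurable]
    refine ne_top_of_le_ne_top ?_ (ENNReal.tsum_le_tsum hint)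
    exact ((summable_geometric_of_lt_one hq0 hlt).mul_left 2).tsum_ofReal_ne_top
  filter_upwards [ae_lt_top (Measurable.tsum hFm) hfin] with x hx
  have ht := ENNReal.tendsto_atTop_zero_of_tsum_ne_top hx.ne
  filter_upwards [ht.eventually_lt_const zero_lt_one] with n hn
  simp only [hF, gaussWeight] at hn
  rw [← ENNReal.ofReal_mul (by positivity), ENNReal.ofReal_lt_one, ← Real.exp_nat_mul,
    ← Real.exp_sum, ← Real.exp_add, Real.exp_lt_one_iff, Finset.sum_neg_distrib,
    ← Finset.sum_div, ← sub_eq_add_neg, mul_div_assoc', ← sub_div, div_neg_iff] at hn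
  have hn' : (n : ℝ) * M < ∑ k ∈ Finset.range n,
      min ((⌊(N : ℝ) / (gaussT N)^[k] x⌋ : ℝ) - N) J := by
    rcases hn with h | h <;> linarith [h.1, h.2]
  rw [mul_comm]
  refine hn'.trans_le (Finset.sum_le_sum fun k _ => (min_le_left _ _).trans ?_)
  linarith [N.cast_nonneg (α := ℝ)]

/-- For Lebesgue almost every `x ∈ [0,1)`, the arithmetic mean of the `N`-continued
fraction coefficients `a_k = ⌊N / T_N^[k-1] x⌋` of `x` diverges to infinity. -/
theorem gaussT_coeff_arith_mean_infinite (N : ℕ) (hN : 0 < N) :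
    ∀ᵐ x ∂(volume.restrict (Set.Ico (0:ℝ) 1)),
      Tendsto (fun n : ℕ =>
          (1 / (n : ℝ)) * ∑ k ∈ Finset.range n, (⌊(N : ℝ) / (gaussT N)^[k] x⌋ : ℝ))
        atTop atTop := by
  filter_upwards [ae_all_iff.2 (ae_eventually_mul_lt_sum_coeff hN)] with x hx
  refine tendsto_atTop.2 fun b => ?_
  obtain ⟨M, hM⟩ := exists_nat_ge b
  filter_upwards [hx M, eventually_gt_atTop 0] with n hn hn0
  have hnp : (0 : ℝ) < n := by exact_mod_cast hn0
  rw [one_div_mul_eq_div, le_div_iff₀ hnp]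
  nlinarith
end
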